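/- Let c ∈ Sₙ be the n-cycle 0 ↦ 1 ↦ ⋯ ↦ n−1 ↦ 0. The map p ↦ s_p is an order isomorphism from the poset NC(n) of non-crossing partitions of Fin n (ordered by refinement) onto the order ideal {σ ∈ Sₙ : σ ≤_T c} of the n-cycle in the absolute order on Sₙ: it is a bijection onto this set, and for all p, q ∈ NC(n), p ⪯ q holds if and only if s_p ≤_T s_q. -/

import Mathlib

open Finset

/-- A partition of `Fin n` is *non-crossing* if there are no indices `a < b < c < d`
such that `a` and `c` lie in one block while `b` and `d` lie in a different block. -/
def IsNoncrossing {n : ℕ} {s : Finset (Fin n)} (P : Finpartition s) : Prop :=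
  ¬ ∃ a b c d : Fin n, a < b ∧ b < c ∧ c < d ∧
    ∃ B ∈ P.parts, ∃ B' ∈ P.parts, B ≠ B' ∧ a ∈ B ∧ c ∈ B ∧ b ∈ B' ∧ d ∈ B'

/-- The poset of non-crossing partitions of `Fin n`, ordered by refinement. -/
abbrev NC (n : ℕ) := {P : Finpartition (univ : Finset (Fin n)) // IsNoncrossing P}

/-- `σ` is the permutation associated to the partition `P`: the product over the blocks
`B = {a₁ < a₂ < ⋯ < a_k}` of `P` of the cycles `a₁ ↦ a₂ ↦ ⋯ ↦ a_k ↦ a₁`.  Pointwise,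
`σ` sends each `x` to the least element of its block that is greater than `x`, if one
exists, and to the least element of its block otherwise. -/
def IsBlockRotation {n : ℕ} (P : Finpartition (univ : Finset (Fin n)))
    (σ : Equiv.Perm (Fin n)) : Prop :=
  ∀ x : Fin n,
    σ x = if h : ((P.part x).filter (x < ·)).Nonempty
      then ((P.part x).filter (x < ·)).min' h
      else (P.part x).min' ⟨x, P.mem_part (Finset.mem_univ x)⟩

/-- The reflection length of a permutation `σ` with respect to the set `T` of
transpositions: the least `k` such that `σ` is a product of `k` transpositions. -/
noncomputable def reflectionLength {n : ℕ} (σ : Equiv.Perm (Fin n)) : ℕ :=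
  sInf {k | ∃ l : List (Equiv.Perm (Fin n)),
    l.length = k ∧ (∀ t ∈ l, t.IsSwap) ∧ l.prod = σ}

/-- The absolute order on the symmetric group: `σ ≤_T τ` iff
`ℓ_T(σ) + ℓ_T(σ⁻¹ τ) = ℓ_T(τ)`. -/
noncomputable def absoluteLe {n : ℕ} (σ τ : Equiv.Perm (Fin n)) : Prop :=
  reflectionLength σ + reflectionLength (σ⁻¹ * τ) = reflectionLength τ

open Equiv in
/-- The number of cycles of a permutation, fixed points included. -/
noncomputable def cycleCount {n : ℕ} (σ : Perm (Fin n)) : ℕ :=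
  Nat.card (Quotient (Perm.SameCycle.setoid σ))

/-- `σ` sends each point to its cyclic successor within its class of `r`. -/
def RotatesClasses {n : ℕ} (r : Fin n → Fin n → Prop) (σ : Equiv.Perm (Fin n)) : Prop :=
  ∀ x, r x (σ x) ∧
    ((x < σ x ∧ ∀ z, r x z → z ≤ x ∨ σ x ≤ z) ∨ (σ x ≤ x ∧ ∀ z, r x z → σ x ≤ z ∧ z ≤ x))

/-- A relation without crossing pairs of related elements. -/
def RelNoncrossing {n : ℕ} (r : Fin n → Fin n → Prop) : Prop :=
  ∀ a b c d, a < b → b < c → c < d → r a c → r b d → r a b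

namespace Setoid

/-- Splits the class of `a` along the interval `(a, b]`. -/
def splitInterval {n : ℕ} (r : Setoid (Fin n)) (a b : Fin n) : Setoid (Fin n) where
  r x y := r x y ∧ (r x a → ((a < x ∧ x ≤ b) ↔ (a < y ∧ y ≤ b)))
  iseqv := by
    refine ⟨fun x => ⟨r.refl x, fun _ => Iff.rfl⟩, fun h => ⟨r.symm h.1, fun h' => ?_⟩,
      fun h h' => ⟨r.trans h.1 h'.1, fun h'' => ?_⟩⟩
    · exact (h.2 (r.trans h.1 h')).symm
    · exact (h.2 h'').trans (h'.2 (r.trans (r.symm h.1) h''))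

theorem splitInterval_apply {n : ℕ} (r : Setoid (Fin n)) (a b x y : Fin n) :
    r.splitInterval a b x y ↔ r x y ∧ (r x a → ((a < x ∧ x ≤ b) ↔ (a < y ∧ y ≤ b))) := Iff.rfl

end Setoid

section CycleCount

open Equiv Equiv.Perm

variable {n : ℕ}

theorem Equiv.Perm.sameCycle_of_rel_apply {σ : Perm (Fin n)} (r : Setoid (Fin n))
    (h : ∀ x, r x (σ x)) {x y : Fin n} (hxy : σ.SameCycle x y) : r x y := by
  obtain ⟨k, rfl⟩ := hxy.exists_nat_pow_eq
  clear hxy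
  induction k with
  | zero => exact r.refl x
  | succ k ih => rw [pow_succ', mul_apply]; exact r.trans ih (h _)

theorem cycleCount_lt {σ π : Perm (Fin n)} (h : ∀ x, σ.SameCycle x (π x)) {a b : Fin n}
    (hab : σ.SameCycle a b) (hab' : ¬ π.SameCycle a b) : cycleCount σ < cycleCount π := by
  classical
  let f : Quotient (SameCycle.setoid π) → Quotient (SameCycle.setoid σ) :=
    Quotient.map' id fun x y hxy => sameCycle_of_rel_apply (SameCycle.setoid σ) h hxy
  have hf : Function.Surjective f := by
    rintro ⟨x⟩
    exact ⟨Quotient.mk'' x, rfl⟩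
  have hf' : ¬ Function.Injective f := fun hinj =>
    hab' (Quotient.exact (@hinj (Quotient.mk'' a) (Quotient.mk'' b) (Quotient.sound hab)))
  rw [cycleCount, cycleCount, Nat.card_eq_fintype_card, Nat.card_eq_fintype_card]
  exact Fintype.card_lt_of_surjective_not_injective f hf hf'

theorem cycleCount_le_cycleCount_mul_swap (σ : Perm (Fin n)) (a b : Fin n) :
    cycleCount σ ≤ cycleCount (σ * swap a b) + 1 := by
  classical
  let r := SameCycle.setoid σ
  let g : Fin n → Quotient r := fun x =>
    if σ.SameCycle x b then Quotient.mk'' a else Quotient.mk'' x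
  have hg1 : ∀ x y, σ.SameCycle x y → g x = g y := by
    intro x y hxy
    have : σ.SameCycle x b ↔ σ.SameCycle y b :=
      ⟨fun h => hxy.symm.trans h, fun h => hxy.trans h⟩
    simp only [g, this]
    split_ifs
    · rfl
    · exact Quotient.sound hxy
  have hgab : g a = g b := by
    simp only [g, SameCycle.refl, if_true, ite_self]
  have hg2 : ∀ x, g x = g ((σ * swap a b) x) := by
    intro x
    have hs : ∀ y, σ.SameCycle y (σ y) := fun y => (SameCycle.refl σ y).apply_right
    rw [mul_apply, ← hg1 _ _ (hs _), swap_apply_def]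
    split_ifs with h1 h2
    · rw [h1, hgab]
    · rw [h2, hgab]
    · rfl
  let f : Quotient (SameCycle.setoid (σ * swap a b)) → Quotient r :=
    Quotient.lift g fun x y hxy =>
      sameCycle_of_rel_apply (Setoid.ker g) hg2 hxy
  have hf : Function.Surjective
      (fun o : Option (Quotient (SameCycle.setoid (σ * swap a b))) =>
        o.elim (Quotient.mk'' b) f) := by
    rintro ⟨x⟩
    by_cases hx : σ.SameCycle x b
    · exact ⟨none, Quotient.sound hx.symm⟩
    · exact ⟨some (Quotient.mk'' x), if_neg hx⟩
  have := Nat.card_le_card_of_surjective _ hf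
  rwa [Finite.card_option] at this

theorem sameCycle_mul_swap {σ : Perm (Fin n)} {a b : Fin n} (h : ¬ σ.SameCycle a b) :
    (σ * swap a b).SameCycle a b := by
  set π := σ * swap a b with hπ
  have key : ∀ k : ℕ, π.SameCycle b ((σ ^ k) (σ a)) := by
    intro k
    induction k with
    | zero =>
      have : σ a = π b := by simp [hπ]
      rw [pow_zero, one_apply, this]
      exact (SameCycle.refl π b).apply_right
    | succ k ih =>
      rw [pow_succ', mul_apply]
      set x := (σ ^ k) (σ a) with hx
      have hax : σ.SameCycle a x := ⟨k + 1, by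
        rw [hx, ← mul_apply, ← pow_succ]; norm_cast⟩
      have hxb : x ≠ b := fun e => h (e ▸ hax)
      by_cases hxa : x = a
      · rw [hxa]
        have : σ a = π b := by simp [hπ]
        rw [this]
        exact (SameCycle.refl π b).apply_right
      · have : σ x = π x := by simp [hπ, swap_apply_of_ne_of_ne hxa hxb]
        rw [this]
        exact ih.apply_right
  have hsa : σ.SameCycle (σ a) a := (SameCycle.refl σ a).apply_left
  obtain ⟨k, hk⟩ := hsa.exists_nat_pow_eq
  have := key k
  rw [hk] at this
  exact this.symm

theorem cycleCount_mul_swap_lt {σ : Perm (Fin n)} {a b : Fin n} (h : ¬ σ.SameCycle a b) :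
    cycleCount (σ * swap a b) < cycleCount σ := by
  have hab := sameCycle_mul_swap h
  refine cycleCount_lt (fun x => ?_) hab h
  by_cases hxa : x = a
  · have : σ a = (σ * swap a b) b := by simp
    rw [hxa, this]
    exact hab.apply_right
  by_cases hxb : x = b
  · have : σ b = (σ * swap a b) a := by simp
    rw [hxb, this]
    exact hab.symm.apply_right
  · have : σ x = (σ * swap a b) x := by simp [swap_apply_of_ne_of_ne hxa hxb]
    rw [this]
    exact (SameCycle.refl _ x).apply_right

theorem cycleCount_one : cycleCount (1 : Perm (Fin n)) = n := by
  have : Function.Bijective (Quotient.mk (SameCycle.setoid (1 : Perm (Fin n)))) :=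
    ⟨fun x y h => sameCycle_one.1 (Quotient.exact h), Quotient.mk_surjective⟩
  rw [cycleCount, ← Nat.card_eq_of_bijective _ this, Nat.card_fin]

theorem cycleCount_le (σ : Perm (Fin n)) : cycleCount σ ≤ n := by
  have := Nat.card_le_card_of_surjective _
    (Quotient.mk_surjective (s := SameCycle.setoid σ))
  rwa [Nat.card_fin] at this

theorem le_length_add_cycleCount (l : List (Perm (Fin n))) (hl : ∀ t ∈ l, t.IsSwap) :
    n ≤ l.length + cycleCount l.prod := by
  induction l using List.reverseRecOn with
  | nil => simp [cycleCount_one]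
  | append_singleton l t ih =>
    have h1 := ih fun t ht => hl t (by simp [ht])
    obtain ⟨a, b, -, rfl⟩ := hl t (by simp)
    have h2 := cycleCount_le_cycleCount_mul_swap l.prod a b
    simp only [List.length_append, List.length_singleton, List.prod_append, List.prod_singleton]
    omega

theorem exists_swaps_length_add_cycleCount_le (σ : Perm (Fin n)) :
    ∃ l : List (Perm (Fin n)), (∀ t ∈ l, t.IsSwap) ∧ l.prod = σ ∧
      l.length + cycleCount σ ≤ n := by
  induction hk : n - cycleCount σ using Nat.strong_induction_on generalizing σ with
  | _ k ih =>
    by_cases hσ : σ = 1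
    · exact ⟨[], by simp, by simp [hσ], by simpa using cycleCount_le σ⟩
    obtain ⟨a, ha⟩ : ∃ a, σ a ≠ a := by
      by_contra! h
      exact hσ (Equiv.ext h)
    set b := σ⁻¹ a with hb
    have hba : b ≠ a := fun e => ha (inv_eq_iff_eq.1 e).symm
    have hσb : σ b = a := by simp [hb]
    set π := σ * swap a b with hπ
    have hπa : π a = a := by simp [hπ, hσb]
    have hlt : cycleCount σ < cycleCount π := by
      refine cycleCount_lt (a := a) (b := b) (fun x => ?_) ?_ ?_
      · have h0 : ∀ x, σ.SameCycle x (σ x) := fun x => (SameCycle.refl σ x).apply_right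
        by_cases hxa : x = a
        · rw [hxa, hπa]
        by_cases hxb : x = b
        · have : π b = σ a := by simp [hπ]
          rw [hxb, this]
          have := h0 b
          rw [hσb] at this
          exact this.trans (h0 a)
        · have : π x = σ x := by simp [hπ, swap_apply_of_ne_of_ne hxa hxb]
          rw [this]
          exact h0 x
      · have : σ.SameCycle b (σ b) := (SameCycle.refl σ b).apply_right
        rw [hσb] at this
        exact this.symm
      · rintro ⟨k, hk⟩
        exact hba (hk ▸ zpow_apply_eq_self_of_apply_eq_self hπa k)
    have hle := cycleCount_le π
    obtain ⟨l, hl, hlp, hlen⟩ := ih (n - cycleCount π) (by omega) π rfl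
    refine ⟨l ++ [swap a b], ?_, ?_, ?_⟩
    · intro t ht
      rcases List.mem_append.1 ht with ht | ht
      · exact hl t ht
      · exact ⟨a, b, hba.symm, by simpa using ht⟩
    · simp [hlp, hπ, mul_assoc]
    · simp only [List.length_append, List.length_singleton]
      omega

theorem reflectionLength_le_length (l : List (Perm (Fin n))) (hl : ∀ t ∈ l, t.IsSwap) :
    reflectionLength l.prod ≤ l.length :=
  Nat.sInf_le ⟨l, rfl, hl, rfl⟩

theorem exists_swaps_length_eq (σ : Perm (Fin n)) :
    ∃ l : List (Perm (Fin n)), l.length = reflectionLength σ ∧ (∀ t ∈ l, t.IsSwap) ∧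
      l.prod = σ := by
  obtain ⟨l, hl, hp, -⟩ := exists_swaps_length_add_cycleCount_le σ
  exact Nat.sInf_mem (s := {k | ∃ l : List (Perm (Fin n)),
    l.length = k ∧ (∀ t ∈ l, t.IsSwap) ∧ l.prod = σ}) ⟨_, l, rfl, hl, hp⟩

theorem reflectionLength_add_cycleCount (σ : Perm (Fin n)) :
    reflectionLength σ + cycleCount σ = n := by
  obtain ⟨l, hl, rfl, hle⟩ := exists_swaps_length_add_cycleCount_le σ
  have h1 := reflectionLength_le_length l hl
  obtain ⟨l', hlen, hl', hp⟩ := exists_swaps_length_eq l.prod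
  have h2 := le_length_add_cycleCount l' hl'
  rw [hp] at h2
  omega

theorem reflectionLength_mul_le (σ τ : Perm (Fin n)) :
    reflectionLength (σ * τ) ≤ reflectionLength σ + reflectionLength τ := by
  obtain ⟨l, hlen, hl, hp⟩ := exists_swaps_length_eq σ
  obtain ⟨l', hlen', hl', hp'⟩ := exists_swaps_length_eq τ
  have := reflectionLength_le_length (l ++ l') fun t ht =>
    (List.mem_append.1 ht).elim (hl t) (hl' t)
  simpa [hlen, hlen', hp, hp'] using this

theorem reflectionLength_swap_le {a b : Fin n} (hab : a ≠ b) :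
    reflectionLength (swap a b) ≤ 1 := by
  simpa using reflectionLength_le_length [swap a b] (by simpa using ⟨a, b, hab, rfl⟩)

theorem reflectionLength_one : reflectionLength (1 : Perm (Fin n)) = 0 :=
  Nat.le_zero.1 (reflectionLength_le_length [] (by simp))

/-- A permutation strictly below `τ` in the absolute order is below some `τ * (a b)` that
splits a cycle of `τ`. -/
theorem absoluteLe.exists_swap {σ τ : Perm (Fin n)} (h : absoluteLe σ τ) (hne : σ ≠ τ) :
    ∃ a b, a < b ∧ τ.SameCycle a b ∧ absoluteLe σ (τ * swap a b) ∧
      reflectionLength (τ * swap a b) < reflectionLength τ := by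
  unfold absoluteLe at h ⊢
  obtain ⟨l, hlen, hl, hp⟩ := exists_swaps_length_eq (σ⁻¹ * τ)
  rcases List.eq_nil_or_concat' l with rfl | ⟨l, t, rfl⟩
  · exact absurd (inv_mul_eq_one.1 hp.symm) hne
  obtain ⟨a, b, hab, rfl⟩ := hl t (by simp)
  have hl1 := reflectionLength_le_length l fun t ht => hl t (by simp [ht])
  have hlp : l.prod = σ⁻¹ * (τ * swap a b) := by
    rw [← mul_assoc, ← hp]
    simp [mul_assoc]
  rw [hlp] at hl1
  have h1 := reflectionLength_mul_le σ (σ⁻¹ * (τ * swap a b))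
  rw [mul_inv_cancel_left] at h1
  have h2 := reflectionLength_mul_le (τ * swap a b) (swap a b)
  rw [mul_assoc, swap_mul_self, mul_one] at h2
  have h3 := reflectionLength_swap_le hab
  simp only [List.length_append, List.length_singleton] at hlen
  have hlt : reflectionLength (τ * swap a b) < reflectionLength τ := by omega
  have hc : τ.SameCycle a b := by
    by_contra hc
    have h4 := cycleCount_mul_swap_lt hc
    have h5 := reflectionLength_add_cycleCount τ
    have h6 := reflectionLength_add_cycleCount (τ * swap a b)
    omega
  rcases lt_or_gt_of_ne hab with hab | hab
  · exact ⟨a, b, hab, hc, by omega, hlt⟩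
  · rw [swap_comm a b] at *
    exact ⟨b, a, hab, hc.symm, by omega, hlt⟩

end CycleCount

section Rotation

open Equiv Equiv.Perm

variable {n : ℕ}

theorem RotatesClasses.eq {r : Setoid (Fin n)} {σ τ : Perm (Fin n)}
    (hσ : RotatesClasses r σ) (hτ : RotatesClasses r τ) : σ = τ := by
  ext1 x
  obtain ⟨h1, h2⟩ := hσ x
  obtain ⟨h3, h4⟩ := hτ x
  have hx := r.refl x
  grind

theorem RotatesClasses.sameCycle_iff {r : Setoid (Fin n)} {σ : Perm (Fin n)}
    (hσ : RotatesClasses r σ) {x y : Fin n} : σ.SameCycle x y ↔ r x y := by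
  classical
  have key : ∀ x y, σ.SameCycle x y → r x y := fun x y h =>
    sameCycle_of_rel_apply r (fun x => (hσ x).1) h
  refine ⟨key x y, fun hxy => ?_⟩
  have hmax : ∀ x, ∃ z, σ.SameCycle x z ∧ ∀ w, r z w → w ≤ z := by
    intro x
    obtain ⟨z, hz, hzmax⟩ := Finset.exists_max_image (univ.filter fun z => σ.SameCycle x z) id
      ⟨x, by simp [SameCycle.refl]⟩
    simp only [mem_filter, mem_univ, true_and, id] at hz hzmax
    refine ⟨z, hz, ?_⟩
    rcases (hσ z).2 with h | h
    · exact absurd (hzmax _ hz.apply_right) (not_le.2 h.1)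
    · exact fun w hw => (h.2 w hw).2
  obtain ⟨z, hz, hz'⟩ := hmax x
  obtain ⟨w, hw, hw'⟩ := hmax y
  have hzw : r z w := r.trans (r.symm (key _ _ hz)) (r.trans hxy (key _ _ hw))
  have : z = w := le_antisymm (hw' _ (r.symm hzw)) (hz' _ hzw)
  exact hz.trans (this ▸ hw.symm)

theorem RotatesClasses.mul_swap {r : Setoid (Fin n)} {σ : Perm (Fin n)}
    (hσ : RotatesClasses r σ) {a b : Fin n} (hab : a < b) (h : r a b) :
    RotatesClasses (r.splitInterval a b) (σ * swap a b) := by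
  intro x
  simp only [Setoid.splitInterval_apply]
  have ha := hσ a
  have hb := hσ b
  have hx := hσ x
  have hsymm : ∀ {u v}, r u v → r v u := fun h => r.symm h
  have htrans : ∀ {u v w}, r u v → r v w → r u w := fun h h' => r.trans h h'
  have hrefl : ∀ u, r u u := r.refl
  by_cases hxa : x = a
  · subst hxa
    have : (σ * swap x b) x = σ b := by simp
    rw [this]
    grind
  by_cases hxb : x = b
  · subst hxb
    have : (σ * swap a x) x = σ a := by simp
    rw [this]
    grind
  have : (σ * swap a b) x = σ x := by simp [swap_apply_of_ne_of_ne hxa hxb]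
  rw [this]
  by_cases hr : r x a
  · have := hx.2
    have := htrans hr h
    grind
  · grind

theorem RelNoncrossing.splitInterval {r : Setoid (Fin n)} (hr : RelNoncrossing r)
    (a b : Fin n) : RelNoncrossing (r.splitInterval a b) := by
  intro x y z w hxy hyz hzw hxz hyw
  simp only [Setoid.splitInterval_apply] at *
  have h := hr x y z w hxy hyz hzw hxz.1 hyw.1
  refine ⟨h, fun hxa => ?_⟩
  have hya : r y a := r.trans (r.symm h) hxa
  have h1 := hxz.2 hxa
  have h2 := hyw.2 hya
  constructor <;> intro h3 <;> constructor <;> grind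

/-- A noncrossing relation strictly finer than `q` is finer than some interval splitting
of `q`. -/
theorem exists_le_splitInterval {p q : Setoid (Fin n)} {σ : Perm (Fin n)}
    (hp : RelNoncrossing p) (hσ : RotatesClasses q σ) (hpq : p < q) :
    ∃ a b, a < b ∧ q a b ∧ p ≤ q.splitInterval a b := by
  classical
  have hle : ∀ {u v}, p u v → q u v := fun h => hpq.le h
  obtain ⟨x, y, hxy, hxy'⟩ : ∃ x y, q x y ∧ ¬ p x y := by
    by_contra! h
    exact hpq.not_ge fun {x y} => h x y
  obtain ⟨m₀, hm₀, hmin₀⟩ := Finset.exists_min_image (univ.filter fun z => q x z) id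
    ⟨x, by simp⟩
  simp only [mem_filter, mem_univ, true_and, id] at hm₀ hmin₀
  obtain ⟨u, hxu, hu⟩ : ∃ u, q x u ∧ ¬ p u m₀ := by
    by_cases h : p x m₀
    · exact ⟨y, hxy, fun h' => hxy' (p.trans h (p.symm h'))⟩
    · exact ⟨x, q.refl x, h⟩
  obtain ⟨m, hm, hmin⟩ := Finset.exists_min_image (univ.filter fun z => p u z) id
    ⟨u, by simp⟩
  obtain ⟨b, hb, hmax⟩ := Finset.exists_max_image (univ.filter fun z => p u z) id
    ⟨u, by simp⟩
  simp only [mem_filter, mem_univ, true_and, id] at hm hmin hb hmax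
  have hmb : m ≤ b := hmin b hb
  have hm₀m : m₀ < m := lt_of_le_of_ne (hmin₀ m (q.trans hxu (hle hm)))
    fun e => hu (e ▸ hm)
  obtain ⟨a, rfl⟩ := σ.surjective m
  have hua : q u a := q.trans (hle hm) (q.symm (hσ a).1)
  have ham₀ : q a m₀ := q.trans (q.symm hua) (q.trans (q.symm hxu) hm₀)
  obtain ⟨ham, hgap⟩ : a < σ a ∧ ∀ z, q a z → z ≤ a ∨ σ a ≤ z := by
    rcases (hσ a).2 with h | h
    · exact h
    · exact absurd (h.2 _ ham₀).1 (not_le.2 hm₀m)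
  refine ⟨a, b, ham.trans_le hmb, q.trans (q.symm hua) (hle hb), ?_⟩
  have key : ∀ v w, p v w → q v a → a < v → v ≤ b → a < w ∧ w ≤ b := by
    intro v w hvw hva hav hvb
    have hσv : σ a ≤ v := (hgap v (q.symm hva)).resolve_left (not_le.2 hav)
    by_cases huv : p u v
    · have huw := p.trans huv hvw
      exact ⟨ham.trans_le (hmin w huw), hmax w huw⟩
    have h1 : σ a < v := lt_of_le_of_ne hσv fun e => huv (e ▸ hm)
    have h2 : v < b := lt_of_le_of_ne hvb fun e => huv (e ▸ hb)
    have hmb' : p (σ a) b := p.trans (p.symm hm) hb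
    by_contra hw
    have hwa : q a w := q.trans (q.symm hva) (hle hvw)
    rcases hgap w hwa with h3 | h3
    · have := hp w (σ a) v b (h3.trans_lt ham) h1 h2 (p.symm hvw) hmb'
      exact huv (p.trans hm (p.trans (p.symm this) (p.symm hvw)))
    · have h4 : b < w := not_le.1 fun h => hw ⟨ham.trans_le h3, h⟩
      exact huv (p.trans hm (hp (σ a) v b w h1 h2 h4 hmb' hvw))
  intro v w hvw
  refine ⟨hle hvw, fun hva => ⟨fun h => key v w hvw hva h.1 h.2, fun h => ?_⟩⟩
  exact key w v (p.symm hvw) (q.trans (q.symm (hle hvw)) hva) h.1 h.2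

end Rotation

namespace Finpartition

variable {n : ℕ}

/-- The equivalence relation of lying in the same block. -/
def toSetoid (P : Finpartition (univ : Finset (Fin n))) : Setoid (Fin n) :=
  Setoid.ker P.part

theorem toSetoid_apply (P : Finpartition (univ : Finset (Fin n))) {x y : Fin n} :
    P.toSetoid x y ↔ y ∈ P.part x := by
  rw [P.mem_part_iff_part_eq_part (mem_univ y) (mem_univ x)]
  exact eq_comm

theorem toSetoid_le_toSetoid {P Q : Finpartition (univ : Finset (Fin n))} :
    P.toSetoid ≤ Q.toSetoid ↔ P ≤ Q := by
  constructor
  · intro h B hB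
    obtain ⟨x, hx⟩ := P.nonempty_of_mem_parts hB
    refine ⟨Q.part x, Q.part_mem.2 (mem_univ x), fun y hy => ?_⟩
    rw [← P.part_eq_of_mem hB hx] at hy
    exact Q.toSetoid_apply.1 (h (P.toSetoid_apply.2 hy))
  · intro h x y hxy
    obtain ⟨B, hB, hle⟩ := h (P.part_mem.2 (mem_univ x))
    have hx : x ∈ B := hle (P.mem_part (mem_univ x))
    have hy : y ∈ B := hle (P.toSetoid_apply.1 hxy)
    rw [← Q.part_eq_of_mem hB hx] at hy
    exact Q.toSetoid_apply.2 hy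

theorem exists_toSetoid_eq (r : Setoid (Fin n)) :
    ∃ P : Finpartition (univ : Finset (Fin n)), P.toSetoid = r := by
  classical
  refine ⟨Finpartition.ofSetoid r, Setoid.ext fun x y => ?_⟩
  rw [toSetoid_apply, Finpartition.mem_part_ofSetoid_iff_rel]

theorem isNoncrossing_iff {P : Finpartition (univ : Finset (Fin n))} :
    IsNoncrossing P ↔ RelNoncrossing P.toSetoid := by
  constructor
  · intro h a b c d hab hbc hcd hac hbd
    by_contra hne
    refine h ⟨a, b, c, d, hab, hbc, hcd, P.part a, P.part_mem.2 (mem_univ _), P.part b,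
      P.part_mem.2 (mem_univ _), hne, P.mem_part (mem_univ _), P.toSetoid_apply.1 hac,
      P.mem_part (mem_univ _), P.toSetoid_apply.1 hbd⟩
  · rintro h ⟨a, b, c, d, hab, hbc, hcd, B, hB, B', hB', hne, ha, hc, hb, hd⟩
    have e : ∀ {D : Finset (Fin n)} {x : Fin n}, D ∈ P.parts → x ∈ D → P.part x = D :=
      fun h h' => P.part_eq_of_mem h h'
    have hab' : P.part a = P.part b := h a b c d hab hbc hcd
      ((e hB ha).trans (e hB hc).symm) ((e hB' hb).trans (e hB' hd).symm)
    exact hne ((e hB ha).symm.trans (hab'.trans (e hB' hb)))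

end Finpartition

theorem IsBlockRotation.rotatesClasses {n : ℕ} {P : Finpartition (univ : Finset (Fin n))}
    {σ : Equiv.Perm (Fin n)} (h : IsBlockRotation P σ) : RotatesClasses P.toSetoid σ := by
  intro x
  simp only [P.toSetoid_apply]
  have hx := h x
  split_ifs at hx with hne
  · have hmem := Finset.min'_mem _ hne
    rw [← hx, mem_filter] at hmem
    refine ⟨hmem.1, Or.inl ⟨hmem.2, fun z hz => ?_⟩⟩
    rcases le_or_gt z x with hzx | hzx
    · exact Or.inl hzx
    · exact Or.inr (hx ▸ Finset.min'_le _ _ (mem_filter.2 ⟨hz, hzx⟩))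
  · have hmin : ∀ z ∈ P.part x, σ x ≤ z := fun z hz => hx ▸ Finset.min'_le _ _ hz
    refine ⟨hx ▸ Finset.min'_mem _ _, Or.inr ⟨hmin x (P.mem_part (mem_univ x)),
      fun z hz => ⟨hmin z hz, ?_⟩⟩⟩
    exact not_lt.1 fun hxz => hne ⟨z, mem_filter.2 ⟨hz, hxz⟩⟩

theorem rotatesClasses_finRotate (n : ℕ) :
    RotatesClasses (⊤ : Setoid (Fin n)) (finRotate n) := by
  cases n with
  | zero => exact fun x => x.elim0
  | succ n =>
    intro x
    refine ⟨trivial, ?_⟩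
    rcases eq_or_ne x (Fin.last n) with rfl | hx
    · rw [finRotate_last]
      exact Or.inr ⟨Fin.zero_le _, fun z _ => ⟨Fin.zero_le _, Fin.le_last _⟩⟩
    · have h := coe_finRotate_of_ne_last hx
      refine Or.inl ⟨Fin.lt_def.2 (by omega), fun z _ => ?_⟩
      rw [Fin.le_def, Fin.le_def]
      omega

section Main

variable {n : ℕ} {s : NC n → Equiv.Perm (Fin n)}

theorem exists_splitInterval_eq (hs : ∀ p : NC n, IsBlockRotation p.val (s p)) (q : NC n)
    {a b : Fin n} (hab : a < b) (h : q.val.toSetoid a b) :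
    ∃ q' : NC n, q'.val.toSetoid = q.val.toSetoid.splitInterval a b ∧
      s q' = s q * Equiv.swap a b := by
  obtain ⟨Q, hQ⟩ := Finpartition.exists_toSetoid_eq (q.val.toSetoid.splitInterval a b)
  have hnc : RelNoncrossing Q.toSetoid :=
    hQ ▸ (Finpartition.isNoncrossing_iff.1 q.property).splitInterval a b
  refine ⟨⟨Q, Finpartition.isNoncrossing_iff.2 hnc⟩, hQ, ?_⟩
  refine RotatesClasses.eq (hs _).rotatesClasses (r := Q.toSetoid) ?_
  rw [hQ]
  exact (hs q).rotatesClasses.mul_swap hab h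

theorem exists_le_of_absoluteLe (hs : ∀ p : NC n, IsBlockRotation p.val (s p))
    (σ : Equiv.Perm (Fin n)) (q : NC n) (h : absoluteLe σ (s q)) : ∃ p ≤ q, s p = σ := by
  induction hk : reflectionLength (s q) using Nat.strong_induction_on generalizing q with
  | _ k ih =>
    by_cases hne : σ = s q
    · exact ⟨q, le_rfl, hne.symm⟩
    obtain ⟨a, b, hab, hc, hle, hlt⟩ := h.exists_swap hne
    obtain ⟨q', hq', hsq'⟩ :=
      exists_splitInterval_eq hs q hab ((hs q).rotatesClasses.sameCycle_iff.1 hc)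
    rw [← hsq'] at hle hlt
    obtain ⟨p, hp, rfl⟩ := ih _ (hk ▸ hlt) q' hle rfl
    refine ⟨p, hp.trans (Finpartition.toSetoid_le_toSetoid.1 ?_), rfl⟩
    rw [hq']
    exact fun {x y} hxy => hxy.1

theorem absoluteLe_of_le (hs : ∀ p : NC n, IsBlockRotation p.val (s p)) {p q : NC n}
    (h : p ≤ q) : absoluteLe (s p) (s q) := by
  induction hk : reflectionLength (s q) using Nat.strong_induction_on generalizing q with
  | _ k ih =>
    unfold absoluteLe
    rcases h.eq_or_lt with rfl | hlt
    · simp [reflectionLength_one]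
    have hlt' : p.val.toSetoid < q.val.toSetoid :=
      lt_of_le_not_ge (Finpartition.toSetoid_le_toSetoid.2 hlt.le)
        fun h' => hlt.not_ge (Finpartition.toSetoid_le_toSetoid.1 h')
    obtain ⟨a, b, hab, hqab, hle⟩ := exists_le_splitInterval
      (Finpartition.isNoncrossing_iff.1 p.property) (hs q).rotatesClasses hlt'
    obtain ⟨q', hq', hsq'⟩ := exists_splitInterval_eq hs q hab hqab
    rw [← hq'] at hle
    have hcyc : cycleCount (s q) < cycleCount (s q') := by
      refine cycleCount_lt (a := a) (b := b) (fun x => ?_)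
        ((hs q).rotatesClasses.sameCycle_iff.2 hqab) fun hc => ?_
      · have := ((hs q').rotatesClasses x).1
        rw [hq'] at this
        exact (hs q).rotatesClasses.sameCycle_iff.2 this.1
      · have := (hs q').rotatesClasses.sameCycle_iff.1 hc
        rw [hq'] at this
        exact lt_irrefl a ((this.2 (Setoid.refl' _ a)).2 ⟨hab, le_rfl⟩).1
    have h1 := reflectionLength_add_cycleCount (s q)
    have h2 := reflectionLength_add_cycleCount (s q')
    have h3 := ih _ (show reflectionLength (s q') < k by omega)
      (Finpartition.toSetoid_le_toSetoid.1 hle : p ≤ q') rfl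
    unfold absoluteLe at h3
    have h4 := reflectionLength_mul_le ((s p)⁻¹ * s q') (Equiv.swap a b)
    rw [hsq', mul_assoc, mul_assoc, Equiv.swap_mul_self, mul_one, ← hsq'] at h4
    have h5 := reflectionLength_swap_le hab.ne
    have h6 := reflectionLength_mul_le (s p) ((s p)⁻¹ * s q)
    rw [mul_inv_cancel_left] at h6
    omega

theorem blockRotation_injective (hs : ∀ p : NC n, IsBlockRotation p.val (s p)) :
    Function.Injective s := by
  intro p q h
  have he : p.val.toSetoid = q.val.toSetoid := Setoid.ext fun x y => by
    rw [← (hs p).rotatesClasses.sameCycle_iff, h, (hs q).rotatesClasses.sameCycle_iff]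
  exact Subtype.ext (le_antisymm (Finpartition.toSetoid_le_toSetoid.1 he.le)
    (Finpartition.toSetoid_le_toSetoid.1 he.ge))

end Main

/-- Let `c = finRotate n` be the `n`-cycle `0 ↦ 1 ↦ ⋯ ↦ n-1 ↦ 0`.  The map `p ↦ s p`
(sending a non-crossing partition to the product of the cycles of its blocks) is an
order isomorphism from `NC n` onto the order ideal `{σ | σ ≤_T c}` of the absolute
order: it is a bijection onto this set, and `p ⪯ q` holds iff `s p ≤_T s q`. -/
theorem noncrossing_orderIso_absolute_ideal (n : ℕ)
    (s : NC n → Equiv.Perm (Fin n)) (hs : ∀ p : NC n, IsBlockRotation p.val (s p)) :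
    Set.BijOn s Set.univ {σ | absoluteLe σ (finRotate n)} ∧
    ∀ p q : NC n, p ≤ q ↔ absoluteLe (s p) (s q) := by
  obtain ⟨P, hP⟩ := Finpartition.exists_toSetoid_eq (⊤ : Setoid (Fin n))
  let t : NC n := ⟨P, Finpartition.isNoncrossing_iff.2 fun _ _ _ _ _ _ _ _ _ => by
    rw [hP]; trivial⟩
  have ht : s t = finRotate n := by
    refine RotatesClasses.eq (r := P.toSetoid) (hs t).rotatesClasses ?_
    rw [hP]
    exact rotatesClasses_finRotate n
  have hle : ∀ p : NC n, p ≤ t := fun p =>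
    (Finpartition.toSetoid_le_toSetoid.1 (hP ▸ le_top) : p.val ≤ P)
  have hinj := blockRotation_injective hs
  refine ⟨⟨fun p _ => ?_, hinj.injOn, fun σ hσ => ?_⟩,
    fun p q => ⟨absoluteLe_of_le hs, fun h => ?_⟩⟩
  · exact ht ▸ absoluteLe_of_le hs (hle p)
  · obtain ⟨p, -, hp⟩ := exists_le_of_absoluteLe hs σ t (ht ▸ hσ)
    exact ⟨p, Set.mem_univ p, hp⟩
  · obtain ⟨p', hp', he⟩ := exists_le_of_absoluteLe hs _ q h
    exact hinj he ▸ hp'
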